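/- arXiv:1809.02038 — 2 statements merged into one kernel-verified Lean document; each statement's English description precedes it below -/
import Mathlib

section
/- Let ϑ > 0 and H ∈ (1/2,3/4). Then lim_{T→∞} (1/T) ∫_{[0,T]⁴} e^{−ϑ|u₂−s₂| − ϑ|u₁−s₁|} |u₂−u₁|^{2H−2} (s₂+s₁)^{2H−2} ds₁ ds₂ du₁ du₂ = 0. -/
open Real MeasureTheory Filter

/-- Monotonicity of the interval integral which does not require the smaller function to be
integrable. -/
lemma intervalIntegral_mono_of_nonneg {f g : ℝ → ℝ} {T : ℝ} (hT : 0 ≤ T)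
    (hg : IntervalIntegrable g volume 0 T) (hf : ∀ x ∈ Set.Ioc 0 T, 0 ≤ f x)
    (hfg : ∀ x ∈ Set.Ioc 0 T, f x ≤ g x) :
    ∫ x in (0 : ℝ)..T, f x ≤ ∫ x in (0 : ℝ)..T, g x := by
  rw [intervalIntegral.integral_of_le hT, intervalIntegral.integral_of_le hT]
  refine integral_mono_of_nonneg ?_ ((intervalIntegrable_iff_integrableOn_Ioc_of_le hT).1 hg) ?_
  · filter_upwards [ae_restrict_mem measurableSet_Ioc] with x hx using hf x hx
  · filter_upwards [ae_restrict_mem measurableSet_Ioc] with x hx using hfg x hx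

lemma intervalIntegral_nonneg_of_Ioc {f : ℝ → ℝ} {T : ℝ} (hT : 0 ≤ T)
    (hf : ∀ x ∈ Set.Ioc 0 T, 0 ≤ f x) : 0 ≤ ∫ x in (0 : ℝ)..T, f x := by
  rw [intervalIntegral.integral_of_le hT]
  exact setIntegral_nonneg measurableSet_Ioc hf

lemma integrable_exp_neg_mul_abs {ϑ : ℝ} (hϑ : 0 < ϑ) :
    Integrable fun x : ℝ => exp (-ϑ * |x|) := by
  rw [← integrableOn_univ, ← Set.Iic_union_Ioi (a := (0 : ℝ))]
  refine IntegrableOn.union ?_ ?_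
  · refine (integrableOn_exp_mul_Iic hϑ 0).congr_fun (fun x hx => ?_) measurableSet_Iic
    simp only [abs_of_nonpos (Set.mem_Iic.1 hx)]
    ring_nf
  · refine (integrableOn_exp_mul_Ioi (neg_lt_zero.2 hϑ) 0).congr_fun (fun x hx => ?_)
      measurableSet_Ioi
    simp only [abs_of_pos (Set.mem_Ioi.1 hx)]

lemma integral_exp_neg_mul_abs_sub_le {ϑ T : ℝ} (hϑ : 0 < ϑ) (hT : 0 ≤ T) (u : ℝ) :
    ∫ s in (0 : ℝ)..T, exp (-ϑ * |u - s|) ≤ ∫ x : ℝ, exp (-ϑ * |x|) := by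
  rw [← integral_sub_left_eq_self (fun x : ℝ => exp (-ϑ * |x|)) volume u,
    intervalIntegral.integral_of_le hT]
  exact setIntegral_le_integral ((integrable_exp_neg_mul_abs hϑ).comp_sub_left u)
    (Eventually.of_forall fun x => (exp_pos _).le)

lemma intervalIntegrable_abs_rpow {p : ℝ} (hp : -1 < p) (a b : ℝ) :
    IntervalIntegrable (fun x : ℝ => |x| ^ p) volume a b := by
  have key : ∀ c : ℝ, 0 ≤ c → IntervalIntegrable (fun x : ℝ => |x| ^ p) volume 0 c := by
    intro c hc
    refine (intervalIntegral.intervalIntegrable_rpow' (a := 0) (b := c) hp).congr ?_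
    intro x hx
    rw [Set.uIoc_of_le hc] at hx
    simp only [abs_of_pos hx.1]
  have key' : ∀ c : ℝ, IntervalIntegrable (fun x : ℝ => |x| ^ p) volume 0 c := by
    intro c
    rcases le_total 0 c with hc | hc
    · exact key c hc
    · simpa using (key (-c) (by linarith)).comp_sub_left 0
  exact (key' a).symm.trans (key' b)

lemma integral_abs_sub_rpow_le {p T u : ℝ} (hp : -1 < p) (hu : u ∈ Set.Ioc 0 T) :
    ∫ x in (0 : ℝ)..T, |u - x| ^ p ≤ 2 * (T ^ (p + 1) / (p + 1)) := by
  have hpos : ∀ c : ℝ, 0 ≤ c → ∫ x in (0 : ℝ)..c, |x| ^ p = c ^ (p + 1) / (p + 1) := by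
    intro c hc
    have : ∫ x in (0 : ℝ)..c, |x| ^ p = ∫ x in (0 : ℝ)..c, x ^ p :=
      intervalIntegral.integral_congr fun x hx => by
        rw [Set.uIcc_of_le hc] at hx
        simp only [abs_of_nonneg hx.1]
    rw [this, integral_rpow (Or.inl hp), zero_rpow (by linarith), sub_zero]
  have hneg : ∫ x in (u - T)..0, |x| ^ p = (T - u) ^ (p + 1) / (p + 1) := by
    rw [← hpos (T - u) (by linarith [hu.2])]
    have := intervalIntegral.integral_comp_neg (a := 0) (b := T - u) (fun x : ℝ => |x| ^ p)
    simpa using this.symm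
  have hmono : ∀ c : ℝ, 0 ≤ c → c ≤ T → c ^ (p + 1) / (p + 1) ≤ T ^ (p + 1) / (p + 1) :=
    fun c hc hcT => div_le_div_of_nonneg_right
      (rpow_le_rpow hc hcT (by linarith)) (by linarith)
  rw [intervalIntegral.integral_comp_sub_left (fun x : ℝ => |x| ^ p) u, sub_zero,
    ← intervalIntegral.integral_add_adjacent_intervals (intervalIntegrable_abs_rpow hp _ 0)
      (intervalIntegrable_abs_rpow hp _ _), hneg, hpos u hu.1.le]
  linarith [hmono u hu.1.le hu.2, hmono (T - u) (by linarith [hu.2]) (by linarith [hu.1])]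

lemma integrable_exp_mul_rpow_prod {ϑ p T : ℝ} (hϑ : 0 < ϑ) (hp : -1 < p) (hT : 0 ≤ T) :
    Integrable (fun z : ℝ × ℝ => exp (-ϑ * |z.1 - z.2|) * z.2 ^ p)
      ((volume.restrict (Set.Ioc 0 T)).prod (volume.restrict (Set.Ioc 0 T))) := by
  have h : Integrable (fun s : ℝ => s ^ p) (volume.restrict (Set.Ioc 0 T)) :=
    (intervalIntegrable_iff_integrableOn_Ioc_of_le hT).1
      (intervalIntegral.intervalIntegrable_rpow' hp)
  refine (h.comp_snd (volume.restrict (Set.Ioc 0 T))).bdd_mul (c := 1)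
    (Continuous.aestronglyMeasurable (by fun_prop)) (Eventually.of_forall fun z => ?_)
  rw [norm_of_nonneg (exp_pos _).le, exp_le_one_iff]
  nlinarith [abs_nonneg (z.1 - z.2)]

lemma intervalIntegrable_exp_mul_rpow {ϑ p : ℝ} (hp : -1 < p) (T u : ℝ) :
    IntervalIntegrable (fun s : ℝ => exp (-ϑ * |u - s|) * s ^ p) volume 0 T :=
  (intervalIntegral.intervalIntegrable_rpow' hp).continuousOn_mul
    (Continuous.continuousOn (by fun_prop))

lemma intervalIntegrable_integral_exp_mul_rpow {ϑ p T : ℝ} (hϑ : 0 < ϑ) (hp : -1 < p)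
    (hT : 0 ≤ T) : IntervalIntegrable
      (fun u : ℝ => ∫ s in (0 : ℝ)..T, exp (-ϑ * |u - s|) * s ^ p) volume 0 T := by
  rw [intervalIntegrable_iff_integrableOn_Ioc_of_le hT]
  simp only [intervalIntegral.integral_of_le hT]
  exact (integrable_exp_mul_rpow_prod hϑ hp hT).integral_prod_left

lemma integral_integral_exp_mul_rpow_le {ϑ p T : ℝ} (hϑ : 0 < ϑ) (hp : -1 < p) (hT : 0 ≤ T) :
    ∫ u in (0 : ℝ)..T, ∫ s in (0 : ℝ)..T, exp (-ϑ * |u - s|) * s ^ p ≤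
      (∫ x : ℝ, exp (-ϑ * |x|)) * (T ^ (p + 1) / (p + 1)) := by
  have hswap : ∫ u in (0 : ℝ)..T, ∫ s in (0 : ℝ)..T, exp (-ϑ * |u - s|) * s ^ p =
      ∫ s in (0 : ℝ)..T, ∫ u in (0 : ℝ)..T, exp (-ϑ * |u - s|) * s ^ p := by
    simp only [intervalIntegral.integral_of_le hT]
    exact integral_integral_swap (integrable_exp_mul_rpow_prod hϑ hp hT)
  rw [hswap]
  calc _ ≤ ∫ s in (0 : ℝ)..T, (∫ x : ℝ, exp (-ϑ * |x|)) * s ^ p := by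
        refine intervalIntegral_mono_of_nonneg hT
          ((intervalIntegral.intervalIntegrable_rpow' hp).const_mul _) ?_ ?_
        · intro s hs
          exact intervalIntegral_nonneg_of_Ioc hT fun u _ =>
            mul_nonneg (exp_pos _).le (rpow_nonneg hs.1.le _)
        · intro s hs
          rw [intervalIntegral.integral_mul_const]
          refine mul_le_mul_of_nonneg_right ?_ (rpow_nonneg hs.1.le _)
          simp only [fun u : ℝ => abs_sub_comm u s]
          exact integral_exp_neg_mul_abs_sub_le hϑ hT s
    _ = _ := by
        rw [intervalIntegral.integral_const_mul, integral_rpow (Or.inl hp),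
          zero_rpow (by linarith), sub_zero]

lemma cross_term_integrand_nonneg {ϑ p s₁ s₂ u₁ u₂ : ℝ} (h₁ : 0 < s₁) (h₂ : 0 < s₂) :
    0 ≤ exp (-ϑ * |u₂ - s₂| - ϑ * |u₁ - s₁|) * |u₂ - u₁| ^ p * (s₂ + s₁) ^ p := by
  positivity

lemma cross_term_le {ϑ p T : ℝ} (hϑ : 0 < ϑ) (hp : -1 < p) (hp' : p ≤ 0) (hT : 0 ≤ T) :
    ∫ u₂ in (0 : ℝ)..T, ∫ u₁ in (0 : ℝ)..T, ∫ s₂ in (0 : ℝ)..T, ∫ s₁ in (0 : ℝ)..T,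
        exp (-ϑ * |u₂ - s₂| - ϑ * |u₁ - s₁|) * |u₂ - u₁| ^ p * (s₂ + s₁) ^ p ≤
      2 * ((∫ x : ℝ, exp (-ϑ * |x|)) * (T ^ (p + 1) / (p + 1))) ^ 2 := by
  set K := ∫ x : ℝ, exp (-ϑ * |x|) with hK
  have hK0 : 0 ≤ K := integral_nonneg fun x => (exp_pos _).le
  set G : ℝ → ℝ := fun u => ∫ s in (0 : ℝ)..T, exp (-ϑ * |u - s|) * s ^ p with hG
  have hG0 : ∀ u, 0 ≤ G u := fun u => intervalIntegral_nonneg_of_Ioc hT fun s hs =>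
    mul_nonneg (exp_pos _).le (rpow_nonneg hs.1.le _)
  have hs₁ : ∀ u₂ u₁ : ℝ, ∀ s₂ ∈ Set.Ioc 0 T, ∫ s₁ in (0 : ℝ)..T,
      exp (-ϑ * |u₂ - s₂| - ϑ * |u₁ - s₁|) * |u₂ - u₁| ^ p * (s₂ + s₁) ^ p ≤
        K * |u₂ - u₁| ^ p * (exp (-ϑ * |u₂ - s₂|) * s₂ ^ p) := by
    intro u₂ u₁ s₂ hs₂
    have hc : 0 ≤ |u₂ - u₁| ^ p * (exp (-ϑ * |u₂ - s₂|) * s₂ ^ p) := by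
      have := hs₂.1
      positivity
    calc _ ≤ ∫ s₁ in (0 : ℝ)..T,
          |u₂ - u₁| ^ p * (exp (-ϑ * |u₂ - s₂|) * s₂ ^ p) * exp (-ϑ * |u₁ - s₁|) := by
          refine intervalIntegral_mono_of_nonneg hT
            (Continuous.intervalIntegrable (by fun_prop) _ _)
            (fun s₁ h => cross_term_integrand_nonneg h.1 hs₂.1) fun s₁ h => ?_
          have hle : (s₂ + s₁) ^ p ≤ s₂ ^ p :=
            rpow_le_rpow_of_nonpos hs₂.1 (by linarith [h.1]) hp'
          have hexp : exp (-ϑ * |u₂ - s₂| - ϑ * |u₁ - s₁|) =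
              exp (-ϑ * |u₂ - s₂|) * exp (-ϑ * |u₁ - s₁|) := by
            rw [← exp_add]
            ring_nf
          rw [hexp]
          calc _ ≤ exp (-ϑ * |u₂ - s₂|) * exp (-ϑ * |u₁ - s₁|) * |u₂ - u₁| ^ p * s₂ ^ p :=
                mul_le_mul_of_nonneg_left hle (by positivity)
            _ = _ := by ring
      _ ≤ |u₂ - u₁| ^ p * (exp (-ϑ * |u₂ - s₂|) * s₂ ^ p) * K := by
          rw [intervalIntegral.integral_const_mul]
          exact mul_le_mul_of_nonneg_left (integral_exp_neg_mul_abs_sub_le hϑ hT u₁) hc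
      _ = _ := by ring
  have hs₂ : ∀ u₂ u₁ : ℝ, ∫ s₂ in (0 : ℝ)..T, ∫ s₁ in (0 : ℝ)..T,
      exp (-ϑ * |u₂ - s₂| - ϑ * |u₁ - s₁|) * |u₂ - u₁| ^ p * (s₂ + s₁) ^ p ≤
        K * G u₂ * |u₂ - u₁| ^ p := by
    intro u₂ u₁
    refine (intervalIntegral_mono_of_nonneg hT
      ((intervalIntegrable_exp_mul_rpow hp T u₂).const_mul _) (fun s₂ h₂ =>
        intervalIntegral_nonneg_of_Ioc hT fun s₁ h₁ => cross_term_integrand_nonneg h₁.1 h₂.1)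
      (hs₁ u₂ u₁)).trans_eq ?_
    rw [intervalIntegral.integral_const_mul]
    ring
  have hu₁ : ∀ u₂ ∈ Set.Ioc 0 T, ∫ u₁ in (0 : ℝ)..T, ∫ s₂ in (0 : ℝ)..T, ∫ s₁ in (0 : ℝ)..T,
      exp (-ϑ * |u₂ - s₂| - ϑ * |u₁ - s₁|) * |u₂ - u₁| ^ p * (s₂ + s₁) ^ p ≤
        K * (2 * (T ^ (p + 1) / (p + 1))) * G u₂ := by
    intro u₂ hu₂
    have hint : IntervalIntegrable (fun u₁ : ℝ => |u₂ - u₁| ^ p) volume 0 T := by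
      simpa using (intervalIntegrable_abs_rpow hp (u₂ - 0) (u₂ - T)).comp_sub_left u₂
    refine (intervalIntegral_mono_of_nonneg hT (hint.const_mul _) (fun u₁ _ =>
      intervalIntegral_nonneg_of_Ioc hT fun s₂ h₂ => intervalIntegral_nonneg_of_Ioc hT
        fun s₁ h₁ => cross_term_integrand_nonneg h₁.1 h₂.1) (fun u₁ _ => hs₂ u₂ u₁)).trans ?_
    rw [intervalIntegral.integral_const_mul]
    calc _ ≤ K * G u₂ * (2 * (T ^ (p + 1) / (p + 1))) :=
          mul_le_mul_of_nonneg_left (integral_abs_sub_rpow_le hp hu₂)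
            (mul_nonneg hK0 (hG0 u₂))
      _ = _ := by ring
  refine (intervalIntegral_mono_of_nonneg hT
    ((intervalIntegrable_integral_exp_mul_rpow hϑ hp hT).const_mul _) (fun u₂ _ =>
      intervalIntegral_nonneg_of_Ioc hT fun u₁ _ => intervalIntegral_nonneg_of_Ioc hT
        fun s₂ h₂ => intervalIntegral_nonneg_of_Ioc hT
          fun s₁ h₁ => cross_term_integrand_nonneg h₁.1 h₂.1) hu₁).trans ?_
  rw [intervalIntegral.integral_const_mul]
  have hM : 0 ≤ T ^ (p + 1) / (p + 1) := div_nonneg (rpow_nonneg hT _) (by linarith)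
  calc _ ≤ K * (2 * (T ^ (p + 1) / (p + 1))) * (K * (T ^ (p + 1) / (p + 1))) :=
        mul_le_mul_of_nonneg_left (integral_integral_exp_mul_rpow_le hϑ hp hT) (by positivity)
    _ = _ := by ring

theorem cross_term_vanishes_mixed (ϑ H : ℝ) (hϑ : 0 < ϑ)
    (hH : H ∈ Set.Ioo (1 / 2 : ℝ) (3 / 4)) :
    Tendsto (fun T : ℝ =>
        (1 / T) * ∫ u₂ in (0 : ℝ)..T, ∫ u₁ in (0 : ℝ)..T, ∫ s₂ in (0 : ℝ)..T,
          ∫ s₁ in (0 : ℝ)..T,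
            Real.exp (-ϑ * |u₂ - s₂| - ϑ * |u₁ - s₁|) *
              |u₂ - u₁| ^ (2 * H - 2) * (s₂ + s₁) ^ (2 * H - 2))
      atTop (nhds 0) := by
  obtain ⟨h₁, h₂⟩ := hH
  have hlim : Tendsto (fun T : ℝ =>
      2 * ((∫ x : ℝ, exp (-ϑ * |x|)) / (2 * H - 2 + 1)) ^ 2 * T ^ (-(3 - 4 * H)))
      atTop (nhds 0) := by
    simpa using (tendsto_rpow_neg_atTop (y := 3 - 4 * H) (by linarith)).const_mul
      (2 * ((∫ x : ℝ, exp (-ϑ * |x|)) / (2 * H - 2 + 1)) ^ 2)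
  refine squeeze_zero' ?_ ?_ hlim
  · filter_upwards [eventually_gt_atTop 0] with T hT
    exact mul_nonneg (by positivity) <| intervalIntegral_nonneg_of_Ioc hT.le fun u₂ _ =>
      intervalIntegral_nonneg_of_Ioc hT.le fun u₁ _ => intervalIntegral_nonneg_of_Ioc hT.le
        fun s₂ h₂ => intervalIntegral_nonneg_of_Ioc hT.le
          fun s₁ h₁ => cross_term_integrand_nonneg h₁.1 h₂.1
  · filter_upwards [eventually_gt_atTop 0] with T hT
    refine (mul_le_mul_of_nonneg_left (cross_term_le hϑ (p := 2 * H - 2) (by linarith)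
      (by linarith) hT.le) (by positivity)).trans_eq ?_
    have hpow : T ^ (-(3 - 4 * H)) = 1 / T * (T ^ (2 * H - 2 + 1)) ^ 2 := by
      rw [← rpow_natCast, ← rpow_mul hT.le, one_div, ← rpow_neg_one, ← rpow_add hT]
      congr 1
      push_cast
      ring
    rw [hpow]
    ring
end

section
/- Let ϑ > 0 and H = 3/4 (so 2H−2 = −1/2). Then lim_{T→∞} (1/(T log T)) ∫_{[0,T]⁴} e^{−ϑ|s₂−u₂| − ϑ|s₁−u₁|} |s₂−s₁|^{−1/2} (u₂+u₁)^{−1/2} du₁ du₂ ds₁ ds₂ = 0, and likewise lim_{T→∞} (1/(T log T)) ∫_{[0,T]⁴} e^{−ϑ|s₂−u₂| − ϑ|s₁−u₁|} (s₂+s₁)^{−1/2} (u₂+u₁)^{−1/2} du₁ du₂ ds₁ ds₂ = 0. -/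
open Real MeasureTheory Filter

open scoped ENNReal

theorem lintegral_exp_neg_mul_abs_lt_top {ϑ : ℝ} (hϑ : 0 < ϑ) :
    ∫⁻ x : ℝ, ENNReal.ofReal (Real.exp (-ϑ * |x|)) < ∞ := by
  have h : Integrable (fun x : ℝ => Real.exp (-ϑ * |x|)) := by
    have h0 : IntegrableOn (fun x : ℝ => Real.exp (-ϑ * |x|)) (Set.Ioi 0) :=
      (integrableOn_exp_mul_Ioi (by linarith : -ϑ < 0) 0).congr_fun
        (fun x hx => by simp only [abs_of_pos (Set.mem_Ioi.1 hx)]) measurableSet_Ioi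
    have h1 : IntegrableOn (fun x : ℝ => Real.exp (-ϑ * |x|)) (Set.Iic 0) :=
      (integrableOn_exp_mul_Iic hϑ 0).congr_fun
        (fun x hx => by simp only [abs_of_nonpos (Set.mem_Iic.1 hx), neg_mul_neg])
        measurableSet_Iic
    rw [← integrableOn_univ, ← Set.Iic_union_Ioi (a := (0 : ℝ))]
    exact h1.union h0
  exact h.lintegral_lt_top

theorem lintegral_Ioc_rpow_neg_half {T : ℝ} (hT : 0 < T) :
    ∫⁻ x in Set.Ioc 0 T, ENNReal.ofReal (x ^ (-(1 / 2) : ℝ)) = ENNReal.ofReal (2 * √T) := by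
  have hi : IntervalIntegrable (fun x : ℝ => x ^ (-(1 / 2) : ℝ)) volume 0 T :=
    intervalIntegral.intervalIntegrable_rpow' (by norm_num)
  rw [intervalIntegrable_iff_integrableOn_Ioc_of_le hT.le] at hi
  rw [← ofReal_integral_eq_lintegral_ofReal hi, ← intervalIntegral.integral_of_le hT.le,
    integral_rpow (Or.inl (by norm_num)), Real.sqrt_eq_rpow]
  · congr 1
    norm_num
    ring
  · filter_upwards [ae_restrict_mem measurableSet_Ioc] with x hx
    exact Real.rpow_nonneg hx.1.le _

theorem lintegral_Ioc_abs_sub_rpow_neg_half_le {T s : ℝ} (hT : 0 < T) (hs : s ∈ Set.Ioc 0 T) :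
    ∫⁻ x in Set.Ioc 0 T, ENNReal.ofReal (|s - x| ^ (-(1 / 2) : ℝ)) ≤
      ENNReal.ofReal (4 * √T) := by
  set h : ℝ → ℝ≥0∞ :=
    (Set.Ioc 0 T).indicator fun x => ENNReal.ofReal (x ^ (-(1 / 2) : ℝ)) with hh
  have hm : Measurable h :=
    Measurable.indicator (by fun_prop) measurableSet_Ioc
  have hI : ∫⁻ x, h x = ENNReal.ofReal (2 * √T) := by
    rw [hh, lintegral_indicator measurableSet_Ioc, lintegral_Ioc_rpow_neg_half hT]
  calc
    _ ≤ ∫⁻ x in Set.Ioc 0 T, (h (s - x) + h (x - s)) := by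
      refine setLIntegral_mono (by fun_prop) fun x hx => ?_
      rcases lt_trichotomy x s with hlt | rfl | hlt
      · have hmem : s - x ∈ Set.Ioc 0 T := ⟨by linarith, by linarith [hx.1, hs.2]⟩
        rw [hh, Set.indicator_of_mem hmem, abs_of_pos hmem.1]
        exact le_self_add
      · rw [sub_self, abs_zero, Real.zero_rpow (by norm_num), ENNReal.ofReal_zero]
        exact zero_le
      · have hmem : x - s ∈ Set.Ioc 0 T := ⟨by linarith, by linarith [hs.1, hx.2]⟩
        rw [hh, Set.indicator_of_mem hmem, abs_sub_comm, abs_of_pos hmem.1]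
        exact le_add_self
    _ ≤ ∫⁻ x, (h (s - x) + h (x - s)) := setLIntegral_le_lintegral _ _
    _ = ENNReal.ofReal (4 * √T) := by
      rw [lintegral_add_left (by fun_prop), lintegral_sub_left_eq_self h s,
        lintegral_sub_right_eq_self h s, hI, ← ENNReal.ofReal_add (by positivity) (by positivity)]
      ring_nf

theorem lintegral_Ioc_add_rpow_neg_half_le {T s : ℝ} (hT : 0 < T) (hs : s ∈ Set.Ioc 0 T) :
    ∫⁻ x in Set.Ioc 0 T, ENNReal.ofReal ((s + x) ^ (-(1 / 2) : ℝ)) ≤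
      ENNReal.ofReal (4 * √T) := by
  calc
    _ ≤ ∫⁻ x in Set.Ioc 0 T, ENNReal.ofReal (x ^ (-(1 / 2) : ℝ)) := by
      refine setLIntegral_mono (by fun_prop) fun x hx => ENNReal.ofReal_le_ofReal ?_
      exact Real.rpow_le_rpow_of_nonpos hx.1 (by linarith [hs.1]) (by norm_num)
    _ = ENNReal.ofReal (2 * √T) := lintegral_Ioc_rpow_neg_half hT
    _ ≤ _ := ENNReal.ofReal_le_ofReal (by linarith [Real.sqrt_nonneg T])

theorem enorm_intervalIntegral_le_setLIntegral {T : ℝ} (hT : 0 < T) (f : ℝ → ℝ)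
    {g : ℝ → ℝ≥0∞} (hfg : ∀ x ∈ Set.Ioc 0 T, ‖f x‖ₑ ≤ g x) :
    ‖∫ x in (0 : ℝ)..T, f x‖ₑ ≤ ∫⁻ x in Set.Ioc 0 T, g x := by
  rw [intervalIntegral.integral_of_le hT.le]
  exact (enorm_integral_le_lintegral_enorm f).trans (setLIntegral_mono' measurableSet_Ioc hfg)

/-- The fourfold integral with a kernel `k` whose sections have mass at most `4 √T` on `(0, T]`
grows at most linearly in `T`. -/
theorem enorm_integral_exp_mul_kernel_le {ϑ T : ℝ} (hT : 0 < T) {k : ℝ → ℝ → ℝ}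
    (hk0 : ∀ s₂ ∈ Set.Ioc 0 T, ∀ s₁ ∈ Set.Ioc 0 T, 0 ≤ k s₂ s₁)
    (hkm : ∀ s₂, Measurable (k s₂))
    (hk : ∀ s₂ ∈ Set.Ioc 0 T,
      ∫⁻ s₁ in Set.Ioc 0 T, ENNReal.ofReal (k s₂ s₁) ≤ ENNReal.ofReal (4 * √T)) :
    ‖∫ s₂ in (0 : ℝ)..T, ∫ s₁ in (0 : ℝ)..T, ∫ u₂ in (0 : ℝ)..T, ∫ u₁ in (0 : ℝ)..T,
        Real.exp (-ϑ * |s₂ - u₂| - ϑ * |s₁ - u₁|) * k s₂ s₁ * (u₂ + u₁) ^ (-(1 / 2) : ℝ)‖ₑ ≤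
      (∫⁻ x : ℝ, ENNReal.ofReal (Real.exp (-ϑ * |x|))) ^ 2 * ENNReal.ofReal (8 * T) := by
  set E : ℝ → ℝ≥0∞ := fun x => ENNReal.ofReal (Real.exp (-ϑ * |x|)) with hE
  set r : ℝ → ℝ≥0∞ := fun x => ENNReal.ofReal (x ^ (-(1 / 2) : ℝ)) with hr
  set A : ℝ≥0∞ := ∫⁻ x, E x with hA
  have hEm : Measurable E := by fun_prop
  have hrm : Measurable r := by fun_prop
  have hEl (s : ℝ) : ∫⁻ u in Set.Ioc 0 T, E (s - u) ≤ A :=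
    (setLIntegral_le_lintegral _ _).trans_eq (lintegral_sub_left_eq_self E s)
  have hEr (u : ℝ) : ∫⁻ s in Set.Ioc 0 T, E (s - u) ≤ A :=
    (setLIntegral_le_lintegral _ _).trans_eq (lintegral_sub_right_eq_self E u)
  have hgm : Measurable fun s => ∫⁻ u in Set.Ioc 0 T, E (s - u) * r u :=
    Measurable.lintegral_prod_right' (f := fun p : ℝ × ℝ => E (p.1 - p.2) * r p.2) (by fun_prop)
  have hpt : ∀ s₂ ∈ Set.Ioc 0 T, ∀ s₁ ∈ Set.Ioc 0 T, ∀ u₂ ∈ Set.Ioc 0 T, ∀ u₁ ∈ Set.Ioc 0 T,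
      ‖Real.exp (-ϑ * |s₂ - u₂| - ϑ * |s₁ - u₁|) * k s₂ s₁ * (u₂ + u₁) ^ (-(1 / 2) : ℝ)‖ₑ ≤
        ENNReal.ofReal (k s₂ s₁) * (E (s₂ - u₂) * r u₂) * E (s₁ - u₁) := by
    intro s₂ hs₂ s₁ hs₁ u₂ hu₂ u₁ hu₁
    have hk' := hk0 s₂ hs₂ s₁ hs₁
    have hu : 0 ≤ u₂ + u₁ := by linarith [hu₂.1, hu₁.1]
    have hu' : 0 ≤ u₂ := hu₂.1.le
    have hle : (u₂ + u₁) ^ (-(1 / 2) : ℝ) ≤ u₂ ^ (-(1 / 2) : ℝ) :=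
      Real.rpow_le_rpow_of_nonpos hu₂.1 (by linarith [hu₁.1]) (by norm_num)
    rw [Real.enorm_eq_ofReal (by positivity), hE, hr, ← ENNReal.ofReal_mul (by positivity),
      ← ENNReal.ofReal_mul (by positivity), ← ENNReal.ofReal_mul (by positivity)]
    refine ENNReal.ofReal_le_ofReal ?_
    rw [show -ϑ * |s₂ - u₂| - ϑ * |s₁ - u₁| = -ϑ * |s₂ - u₂| + -ϑ * |s₁ - u₁| by ring,
      Real.exp_add]
    calc
      _ ≤ Real.exp (-ϑ * |s₂ - u₂|) * Real.exp (-ϑ * |s₁ - u₁|) * k s₂ s₁ *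
          u₂ ^ (-(1 / 2) : ℝ) := by gcongr
      _ = _ := by ring
  calc
    _ ≤ ∫⁻ s₂ in Set.Ioc 0 T, ∫⁻ s₁ in Set.Ioc 0 T, ∫⁻ u₂ in Set.Ioc 0 T,
          ∫⁻ u₁ in Set.Ioc 0 T,
            ENNReal.ofReal (k s₂ s₁) * (E (s₂ - u₂) * r u₂) * E (s₁ - u₁) :=
      enorm_intervalIntegral_le_setLIntegral hT _ fun s₂ hs₂ =>
        enorm_intervalIntegral_le_setLIntegral hT _ fun s₁ hs₁ =>
          enorm_intervalIntegral_le_setLIntegral hT _ fun u₂ hu₂ =>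
            enorm_intervalIntegral_le_setLIntegral hT _ (hpt s₂ hs₂ s₁ hs₁ u₂ hu₂)
    _ ≤ ∫⁻ s₂ in Set.Ioc 0 T, ∫⁻ s₁ in Set.Ioc 0 T, ∫⁻ u₂ in Set.Ioc 0 T,
          ENNReal.ofReal (k s₂ s₁) * (E (s₂ - u₂) * r u₂) * A := by
      gcongr with s₂ s₁ u₂
      rw [lintegral_const_mul _ (by fun_prop)]
      gcongr
      exact hEl s₁
    _ = ∫⁻ s₂ in Set.Ioc 0 T, (∫⁻ s₁ in Set.Ioc 0 T, ENNReal.ofReal (k s₂ s₁)) *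
          (∫⁻ u₂ in Set.Ioc 0 T, E (s₂ - u₂) * r u₂) * A := by
      refine lintegral_congr fun s₂ => ?_
      have hm := (hkm s₂).ennreal_ofReal
      rw [← lintegral_mul_const _ hm, ← lintegral_mul_const _ (by fun_prop)]
      refine lintegral_congr fun s₁ => ?_
      rw [lintegral_mul_const _ (by fun_prop), lintegral_const_mul _ (by fun_prop)]
    _ ≤ ∫⁻ s₂ in Set.Ioc 0 T, ENNReal.ofReal (4 * √T) *
          (∫⁻ u₂ in Set.Ioc 0 T, E (s₂ - u₂) * r u₂) * A :=
      setLIntegral_mono' measurableSet_Ioc fun s₂ hs₂ => by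
        gcongr
        exact hk s₂ hs₂
    _ = ENNReal.ofReal (4 * √T) *
          (∫⁻ u₂ in Set.Ioc 0 T, (∫⁻ s₂ in Set.Ioc 0 T, E (s₂ - u₂)) * r u₂) * A := by
      rw [lintegral_mul_const _ (by fun_prop), lintegral_const_mul _ hgm,
        lintegral_lintegral_swap (by fun_prop)]
      congr 2
      exact lintegral_congr fun u₂ => lintegral_mul_const _ (by fun_prop)
    _ ≤ ENNReal.ofReal (4 * √T) * (∫⁻ u₂ in Set.Ioc 0 T, A * r u₂) * A := by
      gcongr with u₂
      exact hEr u₂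
    _ = A ^ 2 * ENNReal.ofReal (8 * T) := by
      rw [lintegral_const_mul _ hrm, hr, lintegral_Ioc_rpow_neg_half hT,
        show 8 * T = 4 * √T * (2 * √T) by linear_combination -8 * Real.mul_self_sqrt hT.le,
        ENNReal.ofReal_mul (p := 4 * √T) (by positivity)]
      ring

theorem tendsto_integral_exp_mul_kernel_div_mul_log {ϑ : ℝ} (hϑ : 0 < ϑ) {k : ℝ → ℝ → ℝ}
    (hk0 : ∀ s₂, 0 < s₂ → ∀ s₁, 0 < s₁ → 0 ≤ k s₂ s₁)
    (hkm : ∀ s₂, Measurable (k s₂))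
    (hk : ∀ T, 0 < T → ∀ s₂ ∈ Set.Ioc 0 T,
      ∫⁻ s₁ in Set.Ioc 0 T, ENNReal.ofReal (k s₂ s₁) ≤ ENNReal.ofReal (4 * √T)) :
    Tendsto (fun T : ℝ =>
        (1 / (T * Real.log T)) * ∫ s₂ in (0 : ℝ)..T, ∫ s₁ in (0 : ℝ)..T,
          ∫ u₂ in (0 : ℝ)..T, ∫ u₁ in (0 : ℝ)..T,
            Real.exp (-ϑ * |s₂ - u₂| - ϑ * |s₁ - u₁|) * k s₂ s₁ *
              (u₂ + u₁) ^ (-(1 / 2) : ℝ))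
      atTop (nhds 0) := by
  set A : ℝ≥0∞ := ∫⁻ x : ℝ, ENNReal.ofReal (Real.exp (-ϑ * |x|)) with hA
  have hAtop : A ≠ ∞ := (lintegral_exp_neg_mul_abs_lt_top hϑ).ne
  refine squeeze_zero_norm' (a := fun T => 8 * A.toReal ^ 2 / Real.log T) ?_
    (Real.tendsto_log_atTop.const_div_atTop _)
  filter_upwards [eventually_gt_atTop 1] with T hT
  have hT0 : 0 < T := by linarith
  have hlog : 0 < Real.log T := Real.log_pos hT
  have h := enorm_integral_exp_mul_kernel_le (ϑ := ϑ) hT0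
    (fun s₂ hs₂ s₁ hs₁ => hk0 s₂ hs₂.1 s₁ hs₁.1) hkm (hk T hT0)
  have h' := ENNReal.toReal_mono (by finiteness) h
  rw [toReal_enorm, ENNReal.toReal_mul, ENNReal.toReal_pow,
    ENNReal.toReal_ofReal (by positivity)] at h'
  rw [norm_mul, Real.norm_of_nonneg (by positivity)]
  calc
    _ ≤ 1 / (T * Real.log T) * (A.toReal ^ 2 * (8 * T)) := by gcongr
    _ = _ := by field_simp

theorem cross_terms_vanish_critical_hurst (ϑ : ℝ) (hϑ : 0 < ϑ) :
    Tendsto (fun T : ℝ =>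
        (1 / (T * Real.log T)) * ∫ s₂ in (0 : ℝ)..T, ∫ s₁ in (0 : ℝ)..T,
          ∫ u₂ in (0 : ℝ)..T, ∫ u₁ in (0 : ℝ)..T,
            Real.exp (-ϑ * |s₂ - u₂| - ϑ * |s₁ - u₁|) *
              |s₂ - s₁| ^ (-(1 / 2) : ℝ) * (u₂ + u₁) ^ (-(1 / 2) : ℝ))
      atTop (nhds 0) ∧
    Tendsto (fun T : ℝ =>
        (1 / (T * Real.log T)) * ∫ s₂ in (0 : ℝ)..T, ∫ s₁ in (0 : ℝ)..T,
          ∫ u₂ in (0 : ℝ)..T, ∫ u₁ in (0 : ℝ)..T,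
            Real.exp (-ϑ * |s₂ - u₂| - ϑ * |s₁ - u₁|) *
              (s₂ + s₁) ^ (-(1 / 2) : ℝ) * (u₂ + u₁) ^ (-(1 / 2) : ℝ))
      atTop (nhds 0) := by
  constructor
  · exact tendsto_integral_exp_mul_kernel_div_mul_log hϑ
      (fun s₂ _ s₁ _ => Real.rpow_nonneg (abs_nonneg _) _) (fun s₂ => by fun_prop)
      (fun T hT s₂ hs₂ => lintegral_Ioc_abs_sub_rpow_neg_half_le hT hs₂)
  · exact tendsto_integral_exp_mul_kernel_div_mul_log hϑ
      (fun s₂ hs₂ s₁ hs₁ => Real.rpow_nonneg (add_pos hs₂ hs₁).le _) (fun s₂ => by fun_prop)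
      (fun T hT s₂ hs₂ => lintegral_Ioc_add_rpow_neg_half_le hT hs₂)
end
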